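/- Two-stage (three-factor) decomposition of the Tsallis divergence underlying the backward induction: let A, B, C be finite nonempty types and r > 0 with r ≠ 1. Let p_A be a pmf on A, p_B(·|a) a pmf on B for each a, and p_C(·|a,b) a pmf on C for each (a,b), all with strictly positive values; let q_A, q_B, q_C be pmfs on A, B, C with strictly positive values. Define the joint pmfs p(a,b,c) = p_A(a)·p_B(b|a)·p_C(c|a,b) and q(a,b,c) = q_A(a)·q_B(b)·q_C(c) on A × B × C, and write ℓ_A(a) = log_r(p_A(a)/q_A(a)), ℓ_B(a,b) = log_r(p_B(b|a)/q_B(b)), Ā = D_r(p_A‖q_A), B̄(a) = D_r(p_B(·|a)‖q_B), C̄(a,b) = D_r(p_C(·|a,b)‖q_C). Then D_r(p‖q) = ∑_{a,b} p_A(a)·p_B(b|a)·C̄(a,b) + ∑_a p_A(a)·B̄(a) + Ā + (r−1)·[ ∑_a p_A(a)·ℓ_A(a)·B̄(a) + ∑_{a,b} p_A(a)·p_B(b|a)·( ℓ_A(a) + ℓ_B(a,b) + (r−1)·ℓ_A(a)·ℓ_B(a,b) )·C̄(a,b) ]. -/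

import Mathlib

open Finset

/-- The deformed (Tsallis) logarithm `log_r v = (v^(r-1) - 1)/(r-1)`. -/
noncomputable def qlog (r v : ℝ) : ℝ := (v ^ (r - 1) - 1) / (r - 1)

/-- A probability mass function on a finite type. -/
def IsPmf {V : Type*} [Fintype V] (p : V → ℝ) : Prop :=
  (∀ v, 0 ≤ p v) ∧ ∑ v, p v = 1

/-- The Tsallis divergence `D_r(p‖q) = ∑_v p v · log_r (p v / q v)`,
with the convention that terms with `p v = 0` contribute `0`. -/
noncomputable def tsallisDiv (r : ℝ) {V : Type*} [Fintype V] (p q : V → ℝ) : ℝ :=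
  ∑ v, if p v = 0 then 0 else p v * qlog r (p v / q v)

/-- Pseudo-additivity of the deformed logarithm. -/
theorem qlog_mul {r : ℝ} (hr : r ≠ 1) {x y : ℝ} (hx : 0 ≤ x) (hy : 0 ≤ y) :
    qlog r (x * y) = qlog r x + qlog r y + (r - 1) * qlog r x * qlog r y := by
  have h : r - 1 ≠ 0 := sub_ne_zero.mpr hr
  unfold qlog
  rw [Real.mul_rpow hx hy]
  field_simp
  ring

/-- For a positive pmf the divergence is a plain sum. -/
theorem tsallisDiv_of_pos (r : ℝ) {V : Type*} [Fintype V] {p : V → ℝ} (hp : ∀ v, 0 < p v)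
    (q : V → ℝ) : tsallisDiv r p q = ∑ v, p v * qlog r (p v / q v) :=
  Finset.sum_congr rfl fun v _ => if_neg (hp v).ne'

/-- Expectation under a positive pmf of an affine function of the log-ratio. -/
theorem sum_mul_add_mul_qlog (r : ℝ) {V : Type*} [Fintype V] {p : V → ℝ} (hp : ∀ v, 0 < p v)
    (hsum : ∑ v, p v = 1) (q : V → ℝ) (x y : ℝ) :
    ∑ v, p v * (x + y * qlog r (p v / q v)) = x + y * tsallisDiv r p q := by
  rw [tsallisDiv_of_pos r hp, Finset.mul_sum]
  simp only [mul_add, Finset.sum_add_distrib, ← Finset.sum_mul, hsum, one_mul]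
  congr 1
  exact Finset.sum_congr rfl fun v _ => by ring

/-- two-stage (three-factor) decomposition of the Tsallis divergence
underlying the backward induction of Tsallis fully probabilistic design. -/
theorem tsallisDiv_three_factor_decomposition
    {A B C : Type*} [Fintype A] [Nonempty A] [Fintype B] [Nonempty B]
    [Fintype C] [Nonempty C]
    (r : ℝ) (hr0 : 0 < r) (hr1 : r ≠ 1)
    (pA : A → ℝ) (hpA : IsPmf pA) (hpA' : ∀ a, 0 < pA a)
    (pB : A → B → ℝ) (hpB : ∀ a, IsPmf (pB a)) (hpB' : ∀ a b, 0 < pB a b)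
    (pC : A → B → C → ℝ) (hpC : ∀ a b, IsPmf (pC a b)) (hpC' : ∀ a b c, 0 < pC a b c)
    (qA : A → ℝ) (hqA : IsPmf qA) (hqA' : ∀ a, 0 < qA a)
    (qB : B → ℝ) (hqB : IsPmf qB) (hqB' : ∀ b, 0 < qB b)
    (qC : C → ℝ) (hqC : IsPmf qC) (hqC' : ∀ c, 0 < qC c) :
    tsallisDiv r (fun x : A × B × C => pA x.1 * pB x.1 x.2.1 * pC x.1 x.2.1 x.2.2)
        (fun x : A × B × C => qA x.1 * qB x.2.1 * qC x.2.2) =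
      (∑ a, ∑ b, pA a * pB a b * tsallisDiv r (pC a b) qC) +
        (∑ a, pA a * tsallisDiv r (pB a) qB) + tsallisDiv r pA qA +
        (r - 1) *
          ((∑ a, pA a * qlog r (pA a / qA a) * tsallisDiv r (pB a) qB) +
            ∑ a, ∑ b, pA a * pB a b *
              (qlog r (pA a / qA a) + qlog r (pB a b / qB b) +
                (r - 1) * qlog r (pA a / qA a) * qlog r (pB a b / qB b)) *
              tsallisDiv r (pC a b) qC) := by
  have hA : ∀ a, 0 ≤ pA a / qA a := fun a => (div_pos (hpA' a) (hqA' a)).le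
  have hB : ∀ a b, 0 ≤ pB a b / qB b := fun a b => (div_pos (hpB' a b) (hqB' b)).le
  have hC : ∀ a b c, 0 ≤ pC a b c / qC c := fun a b c => (div_pos (hpC' a b c) (hqC' c)).le
  have sum_c : ∀ a b, ∑ c, pA a * pB a b * pC a b c *
        qlog r (pA a * pB a b * pC a b c / (qA a * qB b * qC c)) =
      pA a * (pB a b * (qlog r (pA a / qA a) +
          (1 + (r - 1) * qlog r (pA a / qA a)) * qlog r (pB a b / qB b))) +
        (pA a * pB a b * tsallisDiv r (pC a b) qC +
          (r - 1) * (pA a * pB a b *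
            (qlog r (pA a / qA a) + qlog r (pB a b / qB b) +
              (r - 1) * qlog r (pA a / qA a) * qlog r (pB a b / qB b)) *
            tsallisDiv r (pC a b) qC)) := by
    intro a b
    have key := sum_mul_add_mul_qlog r (hpC' a b) (hpC a b).2 qC
      (qlog r (pA a / qA a * (pB a b / qB b)))
      (1 + (r - 1) * qlog r (pA a / qA a * (pB a b / qB b)))
    calc
      _ = pA a * pB a b * ∑ c, pC a b c * (qlog r (pA a / qA a * (pB a b / qB b)) +
            (1 + (r - 1) * qlog r (pA a / qA a * (pB a b / qB b))) *
              qlog r (pC a b c / qC c)) := by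
        rw [Finset.mul_sum]
        refine Finset.sum_congr rfl fun c _ => ?_
        rw [← div_mul_div_comm, ← div_mul_div_comm,
          qlog_mul hr1 (mul_nonneg (hA a) (hB a b)) (hC a b c)]
        ring
      _ = _ := by
        rw [key, qlog_mul hr1 (hA a) (hB a b)]
        ring
  have sum_a : ∑ a, pA a * (qlog r (pA a / qA a) +
        (1 + (r - 1) * qlog r (pA a / qA a)) * tsallisDiv r (pB a) qB) =
      (∑ a, pA a * tsallisDiv r (pB a) qB) + tsallisDiv r pA qA +
        (r - 1) * ∑ a, pA a * qlog r (pA a / qA a) * tsallisDiv r (pB a) qB := by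
    rw [tsallisDiv_of_pos r hpA', Finset.mul_sum, ← Finset.sum_add_distrib,
      ← Finset.sum_add_distrib]
    exact Finset.sum_congr rfl fun a _ => by ring
  rw [tsallisDiv_of_pos r fun x => mul_pos (mul_pos (hpA' _) (hpB' _ _)) (hpC' _ _ _)]
  simp only [Fintype.sum_prod_type, sum_c, Finset.sum_add_distrib]
  simp only [← Finset.mul_sum, sum_mul_add_mul_qlog r (hpB' _) (hpB _).2, sum_a]
  ring
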